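/- arXiv:1410.4429 — 2 statements merged into one kernel-verified Lean document; each statement's English description precedes it below -/
import Mathlib

section
/- Let A ∈ ℝ^{d₁×n} and B ∈ ℝ^{d₂×n} be nonzero matrices with columns a₁,…,aₙ and b₁,…,bₙ, such that for every i ∈ [n] at least one of aᵢ, bᵢ is nonzero, and define pᵢ = (‖aᵢ‖²/‖A‖_F² + ‖bᵢ‖²/‖B‖_F²)/2. Then max( ‖∑_{i=1}^n (1/pᵢ)·‖bᵢ‖²·aᵢaᵢᵀ − ABᵀBAᵀ‖ , ‖∑_{i=1}^n (1/pᵢ)·‖aᵢ‖²·bᵢbᵢᵀ − BAᵀABᵀ‖ ) ≤ 2·max(sr(A), sr(B))·‖A‖²·‖B‖², where ‖·‖ is the spectral norm. -/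
open Matrix MeasureTheory

/-- The spectral norm (ℓ₂ operator norm) of a real matrix. -/
noncomputable def specNorm {d n : ℕ} (M : Matrix (Fin d) (Fin n) ℝ) : ℝ :=
  ‖LinearMap.toContinuousLinearMap (Matrix.toEuclideanLin M)‖

/-- The Frobenius norm of a real matrix. -/
noncomputable def frobNorm {d n : ℕ} (M : Matrix (Fin d) (Fin n) ℝ) : ℝ :=
  Real.sqrt (∑ i, ∑ j, (M i j) ^ 2)

/-- The stable rank of a matrix: `‖M‖_F² / ‖M‖²`. -/
noncomputable def srank {d n : ℕ} (M : Matrix (Fin d) (Fin n) ℝ) : ℝ :=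
  frobNorm M ^ 2 / specNorm M ^ 2

/-- The Euclidean norm of a vector (e.g. a column of a matrix). -/
noncomputable def colNorm {d : ℕ} (v : Fin d → ℝ) : ℝ := Real.sqrt (∑ i, v i ^ 2)

section L2Operator

open scoped Matrix.Norms.L2Operator

lemma specNorm_eq_l2_opNorm {d n : ℕ} (M : Matrix (Fin d) (Fin n) ℝ) : specNorm M = ‖M‖ := rfl

lemma frobNorm_sq {d n : ℕ} (M : Matrix (Fin d) (Fin n) ℝ) :
    frobNorm M ^ 2 = ∑ i, ∑ j, M i j ^ 2 :=
  Real.sq_sqrt (by positivity)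

lemma norm_toLp_sq {n : ℕ} (x : Fin n → ℝ) : ‖WithLp.toLp 2 x‖ ^ 2 = x ⬝ᵥ x := by
  rw [EuclideanSpace.norm_sq_eq]
  simp [dotProduct, sq]

lemma l2_opNorm_le_of_mulVec {d n : ℕ} (M : Matrix (Fin d) (Fin n) ℝ) {c : ℝ} (hc : 0 ≤ c)
    (h : ∀ x : Fin n → ℝ, (M *ᵥ x) ⬝ᵥ (M *ᵥ x) ≤ c ^ 2 * (x ⬝ᵥ x)) : ‖M‖ ≤ c := by
  rw [Matrix.l2_opNorm_def]
  refine ContinuousLinearMap.opNorm_le_bound _ hc fun x => ?_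
  refine le_of_sq_le_sq ?_ (by positivity)
  have := h (WithLp.ofLp x)
  rw [← norm_toLp_sq, ← norm_toLp_sq] at this
  rw [mul_pow]
  exact this

/-- The Frobenius norm bounds the action of a matrix on Euclidean vectors. -/
lemma mulVec_dotProduct_self_le {d n : ℕ} (M : Matrix (Fin d) (Fin n) ℝ) (x : Fin n → ℝ) :
    (M *ᵥ x) ⬝ᵥ (M *ᵥ x) ≤ frobNorm M ^ 2 * (x ⬝ᵥ x) := by
  rw [frobNorm_sq, Finset.sum_mul]
  refine Finset.sum_le_sum fun i _ => ?_
  have := Finset.sum_mul_sq_le_sq_mul_sq Finset.univ (M i) x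
  simpa only [mulVec, dotProduct, ← sq] using this

lemma frobNorm_transpose {d n : ℕ} (M : Matrix (Fin d) (Fin n) ℝ) :
    frobNorm Mᵀ = frobNorm M := by
  unfold frobNorm
  rw [Finset.sum_comm]
  rfl

lemma l2_opNorm_smul_one_sub_le {d n : ℕ} (M : Matrix (Fin d) (Fin n) ℝ) :
    ‖frobNorm M ^ 2 • (1 : Matrix (Fin n) (Fin n) ℝ) - Mᵀ * M‖ ≤ frobNorm M ^ 2 := by
  refine l2_opNorm_le_of_mulVec _ (sq_nonneg _) fun x => ?_
  have h := mulVec_dotProduct_self_le Mᵀ (M *ᵥ x)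
  rw [frobNorm_transpose] at h
  have hx : x ⬝ᵥ (Mᵀ *ᵥ (M *ᵥ x)) = (M *ᵥ x) ⬝ᵥ (M *ᵥ x) := by
    rw [dotProduct_mulVec, vecMul_transpose]
  have hnn : 0 ≤ (M *ᵥ x) ⬝ᵥ (M *ᵥ x) := by
    rw [← norm_toLp_sq]; positivity
  have hF := mul_nonneg (sq_nonneg (frobNorm M)) hnn
  simp only [sub_mulVec, smul_mulVec, one_mulVec, ← mulVec_mulVec, sub_dotProduct,
    dotProduct_sub, smul_dotProduct, dotProduct_smul, smul_eq_mul,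
    dotProduct_comm (Mᵀ *ᵥ (M *ᵥ x)) x, hx]
  nlinarith

lemma sum_smul_vecMulVec_col {d n : ℕ} (A : Matrix (Fin d) (Fin n) ℝ) (w : Fin n → ℝ) :
    ∑ i, w i • vecMulVec (A · i) (A · i) = A * diagonal w * Aᵀ := by
  ext j k
  simp only [Matrix.sum_apply, Matrix.smul_apply, vecMulVec_apply, smul_eq_mul,
    mul_apply (M := _ * _), mul_diagonal, transpose_apply]
  exact Finset.sum_congr rfl fun i _ => by ring

lemma l2_opNorm_diagonal_sub_gram_le {d n : ℕ} (B : Matrix (Fin d) (Fin n) ℝ) (w : Fin n → ℝ)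
    (hw₀ : ∀ i, 0 ≤ w i) (hw : ∀ i, w i ≤ 2 * frobNorm B ^ 2) :
    ‖diagonal w - Bᵀ * B‖ ≤ 2 * frobNorm B ^ 2 := by
  have hsplit : diagonal w - Bᵀ * B = diagonal (fun i => w i - frobNorm B ^ 2) +
      (frobNorm B ^ 2 • (1 : Matrix (Fin n) (Fin n) ℝ) - Bᵀ * B) := by
    rw [smul_one_eq_diagonal, ← diagonal_sub]
    abel
  have hdiag : ‖diagonal (fun i => w i - frobNorm B ^ 2)‖ ≤ frobNorm B ^ 2 := by
    rw [l2_opNorm_diagonal, pi_norm_le_iff_of_nonneg (sq_nonneg _)]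
    intro i
    rw [Real.norm_eq_abs, abs_le]
    constructor <;> linarith [hw₀ i, hw i]
  rw [hsplit]
  linarith [norm_add_le (diagonal fun i => w i - frobNorm B ^ 2)
    (frobNorm B ^ 2 • (1 : Matrix (Fin n) (Fin n) ℝ) - Bᵀ * B), l2_opNorm_smul_one_sub_le B]

lemma srank_mul_specNorm_sq {d n : ℕ} {B : Matrix (Fin d) (Fin n) ℝ} (hB : B ≠ 0) :
    srank B * specNorm B ^ 2 = frobNorm B ^ 2 := by
  rw [srank, specNorm_eq_l2_opNorm]
  exact div_mul_cancel₀ _ (pow_ne_zero 2 (norm_ne_zero_iff.mpr hB))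

lemma frobNorm_sq_pos {d n : ℕ} {B : Matrix (Fin d) (Fin n) ℝ} (hB : B ≠ 0) :
    0 < frobNorm B ^ 2 := by
  refine (sq_nonneg _).lt_of_ne' fun h0 => hB (Matrix.ext fun i j => ?_)
  rw [frobNorm_sq, Finset.sum_eq_zero_iff_of_nonneg fun _ _ => by positivity] at h0
  have hi := h0 i (Finset.mem_univ i)
  rw [Finset.sum_eq_zero_iff_of_nonneg fun _ _ => by positivity] at hi
  exact pow_eq_zero_iff two_ne_zero |>.mp (hi j (Finset.mem_univ j))

/-- The variance bound for one of the two blocks, with sampling weights that dominate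
`‖bᵢ‖² / (2‖B‖_F²)`. -/
lemma specNorm_weighted_sum_sub_le {d₁ d₂ n : ℕ} (A : Matrix (Fin d₁) (Fin n) ℝ)
    {B : Matrix (Fin d₂) (Fin n) ℝ} (hB : B ≠ 0) (p : Fin n → ℝ) (hp₀ : ∀ i, 0 ≤ p i)
    (hp : ∀ i, colNorm (B · i) ^ 2 / frobNorm B ^ 2 ≤ 2 * p i) :
    specNorm ((∑ i, ((1 / p i) * colNorm (B · i) ^ 2) • vecMulVec (A · i) (A · i)) -
      A * Bᵀ * B * Aᵀ) ≤ 2 * srank B * (specNorm A ^ 2 * specNorm B ^ 2) := by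
  have hF := frobNorm_sq_pos hB
  have hw : ∀ i, 1 / p i * colNorm (B · i) ^ 2 ≤ 2 * frobNorm B ^ 2 := by
    intro i
    rcases (hp₀ i).eq_or_lt with h | h
    · rw [← h]
      simp [hF.le]
    · rw [one_div_mul_eq_div, div_le_iff₀ h]
      have := (div_le_iff₀ hF).mp (hp i)
      linarith
  have hmid := l2_opNorm_diagonal_sub_gram_le B (fun i => 1 / p i * colNorm (B · i) ^ 2)
    (fun i => mul_nonneg (one_div_nonneg.mpr (hp₀ i)) (sq_nonneg _)) hw
  rw [sum_smul_vecMulVec_col A fun i => 1 / p i * colNorm (B · i) ^ 2]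
  set D := diagonal fun i => 1 / p i * colNorm (B · i) ^ 2
  have hfac : A * D * Aᵀ - A * Bᵀ * B * Aᵀ = A * (D - Bᵀ * B) * Aᵀ := by
    rw [Matrix.mul_sub, Matrix.sub_mul, ← Matrix.mul_assoc A Bᵀ B]
  have hT : ‖Aᵀ‖ = ‖A‖ := by
    rw [← conjTranspose_eq_transpose_of_trivial, l2_opNorm_conjTranspose]
  have hrhs : 2 * srank B * (specNorm A ^ 2 * specNorm B ^ 2) =
      ‖A‖ * (2 * frobNorm B ^ 2) * ‖A‖ := by
    rw [← srank_mul_specNorm_sq hB, specNorm_eq_l2_opNorm A]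
    ring
  rw [hfac, hrhs, specNorm_eq_l2_opNorm]
  calc ‖A * (D - Bᵀ * B) * Aᵀ‖ ≤ ‖A * (D - Bᵀ * B)‖ * ‖Aᵀ‖ := l2_opNorm_mul _ _
    _ ≤ ‖A‖ * ‖D - Bᵀ * B‖ * ‖A‖ := by
      rw [hT]
      gcongr
      exact l2_opNorm_mul _ _
    _ ≤ ‖A‖ * (2 * frobNorm B ^ 2) * ‖A‖ := by gcongr

end L2Operator

/-- Claim 2 (variance bound): the spectral norms of the two diagonal blocks of `E Z₁²`
are both at most `2·(sr(A) ∨ sr(B))·‖A‖²‖B‖²`. -/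
theorem stmt4 {d₁ d₂ n : ℕ}
    (A : Matrix (Fin d₁) (Fin n) ℝ) (B : Matrix (Fin d₂) (Fin n) ℝ)
    (hA : A ≠ 0) (hB : B ≠ 0)
    (hcol : ∀ i : Fin n, (fun k => A k i) ≠ 0 ∨ (fun k => B k i) ≠ 0)
    (p : Fin n → ℝ)
    (hp : ∀ i : Fin n, p i =
      (colNorm (A · i) ^ 2 / frobNorm A ^ 2 + colNorm (B · i) ^ 2 / frobNorm B ^ 2) / 2) :
    max
      (specNorm ((∑ i : Fin n, ((1 / p i) * colNorm (B · i) ^ 2) •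
          Matrix.vecMulVec (A · i) (A · i)) - A * Bᵀ * B * Aᵀ))
      (specNorm ((∑ i : Fin n, ((1 / p i) * colNorm (A · i) ^ 2) •
          Matrix.vecMulVec (B · i) (B · i)) - B * Aᵀ * A * Bᵀ))
      ≤ 2 * max (srank A) (srank B) * (specNorm A ^ 2 * specNorm B ^ 2) := by
  have ha : ∀ i, 0 ≤ colNorm (A · i) ^ 2 / frobNorm A ^ 2 := fun i => by positivity
  have hb : ∀ i, 0 ≤ colNorm (B · i) ^ 2 / frobNorm B ^ 2 := fun i => by positivity
  have hp₀ : ∀ i, 0 ≤ p i := fun i => by rw [hp i]; linarith [ha i, hb i]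
  refine max_le ?_ ?_
  · refine (specNorm_weighted_sum_sub_le A hB p hp₀ fun i => ?_).trans ?_
    · rw [hp i]
      linarith [ha i]
    · gcongr
      exact le_max_right _ _
  · refine (specNorm_weighted_sum_sub_le B hA p hp₀ fun i => ?_).trans ?_
    · rw [hp i]
      linarith [hb i]
    · rw [mul_comm (specNorm B ^ 2)]
      gcongr
      exact le_max_left _ _
end

section
/- Let A ∈ ℝ^{d₁×n} and B ∈ ℝ^{d₂×n} be nonzero matrices with columns a₁,…,aₙ and b₁,…,bₙ, such that for every i ∈ [n] at least one of aᵢ, bᵢ is nonzero, and define pᵢ = (‖aᵢ‖²/‖A‖_F² + ‖bᵢ‖²/‖B‖_F²)/2. Then ∑_{i=1}^n (1/pᵢ)·‖bᵢ‖²·aᵢaᵢᵀ ⪯ 2·‖B‖_F²·AAᵀ in the Loewner (positive semidefinite) order. -/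
open Matrix MeasureTheory

theorem frobNorm_pos {d n : ℕ} {M : Matrix (Fin d) (Fin n) ℝ} (hM : M ≠ 0) : 0 < frobNorm M := by
  obtain ⟨i, j, hij⟩ : ∃ i j, M i j ≠ 0 := by
    by_contra! h
    exact hM (Matrix.ext h)
  refine Real.sqrt_pos.2 (Finset.sum_pos' (fun k _ => Finset.sum_nonneg fun l _ => sq_nonneg _)
    ⟨i, Finset.mem_univ i, Finset.sum_pos' (fun l _ => sq_nonneg _) ⟨j, Finset.mem_univ j, ?_⟩⟩)
  positivity

theorem mul_transpose_eq_sum_vecMulVec {m n R : Type*} [Fintype n] [NonUnitalNonAssocSemiring R]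
    (A : Matrix m n R) : A * Aᵀ = ∑ i, Matrix.vecMulVec (A · i) (A · i) := by
  ext k l
  simp [Matrix.mul_apply, Matrix.sum_apply, Matrix.vecMulVec_apply]

theorem one_div_avg_mul_le {x b f : ℝ} (hx : 0 ≤ x) (hb : 0 ≤ b) (hf : 0 < f) :
    1 / ((x + b / f) / 2) * b ≤ 2 * f := by
  rcases hb.eq_or_lt with rfl | hb
  · simpa using hf.le
  · have hbf : 0 < b / f := div_pos hb hf
    rw [one_div_mul_eq_div, div_le_iff₀ (by linarith)]
    have hcancel : f * (b / f) = b := mul_div_cancel₀ b hf.ne'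
    nlinarith [mul_nonneg hf.le hx]

/-- `∑ᵢ (1/pᵢ)·‖bᵢ‖²·aᵢaᵢᵀ ⪯ 2·‖B‖_F²·AAᵀ` in the Loewner order, for the mixed
column-norm sampling probabilities. -/
theorem stmt6 {d₁ d₂ n : ℕ}
    (A : Matrix (Fin d₁) (Fin n) ℝ) (B : Matrix (Fin d₂) (Fin n) ℝ)
    (hA : A ≠ 0) (hB : B ≠ 0)
    (hcol : ∀ i : Fin n, (fun k => A k i) ≠ 0 ∨ (fun k => B k i) ≠ 0)
    (p : Fin n → ℝ)
    (hp : ∀ i : Fin n, p i =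
      (colNorm (A · i) ^ 2 / frobNorm A ^ 2 + colNorm (B · i) ^ 2 / frobNorm B ^ 2) / 2) :
    ((2 * frobNorm B ^ 2) • (A * Aᵀ)
      - ∑ i : Fin n, ((1 / p i) * colNorm (B · i) ^ 2) • Matrix.vecMulVec (A · i) (A · i)
      ).PosSemidef := by
  rw [mul_transpose_eq_sum_vecMulVec, Finset.smul_sum, ← Finset.sum_sub_distrib]
  refine Matrix.posSemidef_sum _ fun i _ => ?_
  rw [← sub_smul]
  have hrank : (Matrix.vecMulVec (A · i) (A · i)).PosSemidef := by
    simpa using Matrix.posSemidef_vecMulVec_self_star (A · i)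
  refine hrank.smul (sub_nonneg.2 ?_)
  rw [hp i]
  exact one_div_avg_mul_le (by positivity) (sq_nonneg _) (pow_pos (frobNorm_pos hB) 2)
end
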